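/- For each r ∈ ℕ_+, the sequence (D_r(n)/(n+r)!)_{n ∈ ℕ} converges to 1/(r!·e) as n → ∞, where e is Euler's number. -/

import Mathlib

/-- The `r`-derangement number `D_r(n)`: the number of fixed-point-free permutations
of `n + r` elements such that the first `r` (distinguished) elements lie in pairwise
distinct cycles of the cycle decomposition. -/
noncomputable def rDerangement (r n : ℕ) : ℕ :=
  Nat.card {σ : Equiv.Perm (Fin (n + r)) //
    (∀ x, σ x ≠ x) ∧
    ∀ i j : Fin (n + r), (i : ℕ) < r → (j : ℕ) < r → i ≠ j → ¬ σ.SameCycle i j}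

set_option linter.unusedSectionVars false

namespace RDer

open Equiv

variable {α : Type*} [Fintype α] [DecidableEq α]

/-- distinct elements of `R` lie in distinct cycles -/
def Dist (R : α → Prop) (σ : Perm α) : Prop :=
  ∀ i j, R i → R j → i ≠ j → ¬ σ.SameCycle i j

/-- derangement not mapping any element of `R` into `R` -/
def Good (R : α → Prop) (σ : Perm α) : Prop :=
  (∀ x, σ x ≠ x) ∧ ∀ x, R x → ¬ R (σ x)

lemma pow_mul_eq (R : α → Prop) (τ σ : Perm α) (hτ : ∀ x, ¬ R x → τ x = x) (a : α) (k : ℕ)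
    (h : ∀ j, 0 < j → j < k → ¬ R ((σ ^ j) a)) :
    ∀ j, j < k → ((τ * σ) ^ j) a = (σ ^ j) a := by
  intro j
  induction j with
  | zero => simp
  | succ j ih =>
    intro hj
    rw [pow_succ', Perm.mul_apply, ih (by omega), Perm.mul_apply, ← Perm.mul_apply σ, ← pow_succ']
    exact hτ _ (h _ (by omega) hj)

lemma pow_mul_eq' (R : α → Prop) (τ σ : Perm α) (hτ : ∀ x, ¬ R x → τ x = x) (a : α) (k : ℕ)
    (hk : 0 < k) (h : ∀ j, 0 < j → j < k → ¬ R ((σ ^ j) a)) :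
    ((τ * σ) ^ k) a = τ ((σ ^ k) a) := by
  obtain ⟨k, rfl⟩ : ∃ l, k = l + 1 := ⟨k - 1, by omega⟩
  rw [pow_succ', Perm.mul_apply, pow_mul_eq R τ σ hτ a _ h k (by omega), Perm.mul_apply,
    ← Perm.mul_apply σ, ← pow_succ']

lemma exists_ret (R : α → Prop) (σ : Perm α) (a : α) (ha : R a) :
    ∃ k, 0 < k ∧ R ((σ ^ k) a) ∧ ∀ j, 0 < j → j < k → ¬ R ((σ ^ j) a) := by
  classical
  have hex : ∃ k, 0 < k ∧ R ((σ ^ k) a) :=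
    ⟨orderOf σ, orderOf_pos σ, by simpa [pow_orderOf_eq_one] using ha⟩
  refine ⟨Nat.find hex, (Nat.find_spec hex).1, (Nat.find_spec hex).2, fun j h0 hj hR => ?_⟩
  exact Nat.find_min hex hj ⟨h0, hR⟩

lemma dist_unique (R : α → Prop) (τ σ : Perm α) (hτ : ∀ x, ¬ R x → τ x = x)
    (hτ' : ∀ x, R x → R (τ x))
    (h1 : Dist R σ) (h2 : Dist R (τ * σ)) : τ = 1 := by
  ext a
  by_cases ha : R a
  · obtain ⟨k, hk, hR, hmin⟩ := exists_ret R σ a ha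
    have hka : (σ ^ k) a = a := by
      by_contra hne
      exact h1 a _ ha hR (Ne.symm hne) ⟨k, by simp⟩
    have := pow_mul_eq' R τ σ hτ a k hk hmin
    rw [hka] at this
    by_contra hne
    exact h2 a (τ a) ha (hτ' a ha) (Ne.symm hne) ⟨k, by rw [zpow_natCast, this]⟩
  · simp [hτ a ha]

lemma dist_exists (R : α → Prop) [DecidablePred R] (σ : Perm α) :
    ∃ τ : Perm (Subtype R), Dist R (Perm.ofSubtype τ * σ) := by
  choose k hk hR hmin using fun a : Subtype R => exists_ret R σ a.1 a.2
  let ρ : Subtype R → Subtype R := fun a => ⟨(σ ^ k a) a.1, hR a⟩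
  have key : ∀ a b : Subtype R, k a ≤ k b → ρ a = ρ b → a = b := by
    intro a b hab h
    have h' : (σ ^ k a) a.1 = (σ ^ k b) b.1 := congrArg Subtype.val h
    have e : (σ ^ k b) b.1 = (σ ^ k a) ((σ ^ (k b - k a)) b.1) := by
      rw [← Perm.mul_apply, ← pow_add]; congr 2; omega
    rw [e] at h'
    have h2 := (σ ^ k a).injective h'
    rcases Nat.eq_zero_or_pos (k b - k a) with h0 | h0
    · rw [h0] at h2; exact Subtype.ext (by simpa using h2)
    · exact absurd (h2 ▸ a.2) (hmin b _ h0 (by have := hk a; omega))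
  have hinj : Function.Injective ρ := by
    intro a b h
    rcases le_total (k a) (k b) with hab | hab
    · exact key a b hab h
    · exact (key b a hab h.symm).symm
  let ρe : Perm (Subtype R) := Equiv.ofBijective ρ (Finite.injective_iff_bijective.mp hinj)
  refine ⟨ρe⁻¹, ?_⟩
  set τ := Perm.ofSubtype ρe⁻¹ with hτdef
  have hτ : ∀ x, ¬ R x → τ x = x := fun x hx => Perm.ofSubtype_apply_of_not_mem _ hx
  intro i j hi hj hne hs
  have hret : ((τ * σ) ^ (k ⟨i, hi⟩)) i = i := by
    rw [pow_mul_eq' R τ σ hτ i _ (hk ⟨i, hi⟩) (hmin ⟨i, hi⟩)]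
    rw [hτdef, Perm.ofSubtype_apply_of_mem _ (hR ⟨i, hi⟩)]
    have : (⟨(σ ^ k ⟨i, hi⟩) i, hR ⟨i, hi⟩⟩ : Subtype R) = ρe ⟨i, hi⟩ := rfl
    rw [this]; simp
  obtain ⟨l, -, hl⟩ := hs.exists_pow_eq'
  set K := k ⟨i, hi⟩ with hK
  have hmod : ((τ * σ) ^ (l % K)) i = j := by
    rw [← hl]
    conv_rhs => rw [← Nat.mod_add_div l K, pow_add, pow_mul, Perm.mul_apply]
    congr 1
    exact (Perm.pow_apply_eq_self_of_apply_eq_self hret _).symm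
  have hlt : l % K < K := Nat.mod_lt _ (hk ⟨i, hi⟩)
  rcases Nat.eq_zero_or_pos (l % K) with h0 | h0
  · rw [h0] at hmod; exact hne (by simpa using hmod)
  · rw [pow_mul_eq R τ σ hτ i K (hmin ⟨i, hi⟩) _ hlt] at hmod
    exact hmin ⟨i, hi⟩ _ h0 hlt (by rw [hmod]; exact hj)

lemma mem_ofSubtype (R : α → Prop) [DecidablePred R] (τ : Perm (Subtype R)) (x : α) :
    R (Perm.ofSubtype τ x) ↔ R x := by
  by_cases hx : R x
  · rw [Perm.ofSubtype_apply_of_mem _ hx]; exact ⟨fun _ => hx, fun _ => (τ _).2⟩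
  · rw [Perm.ofSubtype_apply_of_not_mem _ hx]

lemma good_mul (R : α → Prop) [DecidablePred R] (τ : Perm (Subtype R)) (σ : Perm α)
    (h : Good R σ) : Good R (Perm.ofSubtype τ * σ) := by
  refine ⟨fun x => ?_, fun x hx => ?_⟩
  · rw [Perm.mul_apply]
    by_cases hs : R (σ x)
    · intro he
      have h1 : R x := by rw [← he]; exact (mem_ofSubtype R τ _).2 hs
      exact h.2 x h1 hs
    · rw [Perm.ofSubtype_apply_of_not_mem _ hs]; exact h.1 x
  · rw [Perm.mul_apply, mem_ofSubtype R]; exact h.2 x hx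

lemma card_good (R : α → Prop) [DecidablePred R] :
    (Nat.card (Subtype R)).factorial * Nat.card {σ : Perm α // Good R σ ∧ Dist R σ}
      = Nat.card {σ : Perm α // Good R σ} := by
  have e1 : (Nat.card (Subtype R)).factorial = Nat.card (Perm (Subtype R)) := by
    rw [Nat.card_perm]
  rw [e1, ← Nat.card_prod]
  refine Nat.card_congr (Equiv.ofBijective
    (fun p => ⟨Perm.ofSubtype p.1 * p.2.1, good_mul R p.1 p.2.1 p.2.2.1⟩) ⟨?_, ?_⟩)
  · rintro ⟨τ, σ, hσ⟩ ⟨τ', σ', hσ'⟩ h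
    have h : Perm.ofSubtype τ * σ = Perm.ofSubtype τ' * σ' := congrArg Subtype.val h
    have h2 : σ' = Perm.ofSubtype (τ'⁻¹ * τ) * σ := by
      rw [map_mul, map_inv, mul_assoc, h]; simp
    have h3 : Perm.ofSubtype (τ'⁻¹ * τ) = (1 : Perm α) := by
      apply dist_unique R _ σ (fun x hx => Perm.ofSubtype_apply_of_not_mem _ hx)
        (fun x hx => (mem_ofSubtype R _ x).2 hx) hσ.2
      rw [← h2]; exact hσ'.2
    have h4 : τ'⁻¹ * τ = 1 := Perm.ofSubtype_injective (by rw [h3, map_one])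
    have h5 : τ = τ' := (inv_mul_eq_one.mp h4).symm
    subst h5
    have : σ = σ' := mul_left_cancel h
    subst this
    rfl
  · rintro ⟨σ, hσ⟩
    obtain ⟨τ, hτ⟩ := dist_exists R σ
    refine ⟨⟨τ⁻¹, ⟨Perm.ofSubtype τ * σ, good_mul R τ σ hσ, hτ⟩⟩, ?_⟩
    apply Subtype.ext
    simp

lemma card_fix (x y : α) :
    Nat.card {σ : Perm α // σ x = y} * Nat.card α ≤ (Nat.card α).factorial := by
  rw [← Nat.card_prod, ← Nat.card_perm]
  refine Nat.card_le_card_of_injective (fun p => Equiv.swap y p.2 * p.1.1) ?_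
  rintro ⟨⟨σ, hσ⟩, z⟩ ⟨⟨σ', hσ'⟩, z'⟩ h
  have h : Equiv.swap y z * σ = Equiv.swap y z' * σ' := h
  have hz : z = z' := by
    have := congrArg (fun f : Perm α => f x) h
    simpa [hσ, hσ'] using this
  subst hz
  have : σ = σ' := mul_left_cancel h
  subst this
  rfl

lemma card_bad (R : α → Prop) [DecidablePred R] :
    Nat.card {σ : Perm α // ∃ x, R x ∧ R (σ x)} * Nat.card α
      ≤ Nat.card (Subtype R) ^ 2 * (Nat.card α).factorial := by
  have h1 : Nat.card {σ : Perm α // ∃ x, R x ∧ R (σ x)}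
      ≤ Nat.card (Σ p : Subtype R × Subtype R, {σ : Perm α // σ p.1.1 = p.2.1}) := by
    refine Nat.card_le_card_of_injective
      (fun σ => ⟨(⟨σ.2.choose, σ.2.choose_spec.1⟩, ⟨_, σ.2.choose_spec.2⟩), ⟨σ.1, rfl⟩⟩) ?_
    intro σ σ' h
    apply Subtype.ext
    have := congrArg (fun q : (Σ p : Subtype R × Subtype R,
      {σ : Perm α // σ p.1.1 = p.2.1}) => q.2.1) h
    exact this
  refine (Nat.mul_le_mul_right _ h1).trans ?_
  rw [Nat.card_sigma, Finset.sum_mul]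
  refine (Finset.sum_le_card_nsmul _ _ _ (fun p _ => card_fix p.1.1 p.2.1)).trans ?_
  simp [Fintype.card_prod, sq]

end RDer

open RDer in
theorem rDer_bounds (r n : ℕ) : ∃ g b : ℕ,
    g ≤ rDerangement r n ∧ rDerangement r n ≤ g + b ∧
    r.factorial * g ≤ numDerangements (n + r) ∧ numDerangements (n + r) ≤ r.factorial * g + b ∧
    b * (n + r) ≤ r ^ 2 * (n + r).factorial := by
  classical
  let R : Fin (n + r) → Prop := fun i => (i : ℕ) < r
  have hR : Nat.card (Subtype R) = r := by
    let e : Subtype R ≃ Fin r :=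
      { toFun := fun x => ⟨x.1.1, x.2⟩
        invFun := fun x => ⟨⟨x.1, by omega⟩, x.2⟩
        left_inv := fun x => rfl
        right_inv := fun x => rfl }
    simpa using Nat.card_congr e
  have hg := card_good R
  have hb := card_bad R
  rw [hR] at hg hb
  rw [Nat.card_fin] at hb
  have hnum : numDerangements (n + r) = Nat.card {σ : Equiv.Perm (Fin (n + r)) // ∀ x, σ x ≠ x} := by
    have := card_derangements_eq_numDerangements (Fin (n + r))
    rw [Fintype.card_fin] at this
    rw [← this, ← Nat.card_eq_fintype_card]
    rfl
  have conv : ∀ P : Equiv.Perm (Fin (n + r)) → Prop,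
      Nat.card {σ // P σ} = (Finset.univ.filter P).card := by
    intro P; rw [Nat.card_eq_fintype_card, Fintype.card_subtype]
  refine ⟨Nat.card {σ : Equiv.Perm (Fin (n + r)) // Good R σ ∧ RDer.Dist R σ},
    _, ?_, ?_, ?_, ?_, hb⟩
  · unfold rDerangement
    rw [conv, conv]
    refine Finset.card_le_card fun σ => ?_
    simp only [Finset.mem_filter, Finset.mem_univ, true_and]
    exact fun h => ⟨h.1.1, h.2⟩
  · unfold rDerangement
    rw [conv, conv, conv]
    refine (Finset.card_le_card fun σ => ?_).trans (Finset.card_union_le _ _)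
    simp only [Finset.mem_filter, Finset.mem_univ, true_and, Finset.mem_union]
    intro h
    by_cases hx : ∃ x, R x ∧ R (σ x)
    · exact Or.inr hx
    · exact Or.inl ⟨⟨h.1, fun x h1 h2 => hx ⟨x, h1, h2⟩⟩, h.2⟩
  · rw [hg, hnum, conv, conv]
    refine Finset.card_le_card fun σ => ?_
    simp only [Finset.mem_filter, Finset.mem_univ, true_and]
    exact fun h => h.1
  · rw [hg, hnum, conv, conv, conv]
    refine (Finset.card_le_card fun σ => ?_).trans (Finset.card_union_le _ _)
    simp only [Finset.mem_filter, Finset.mem_univ, true_and, Finset.mem_union]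
    intro h
    by_cases hx : ∃ x, R x ∧ R (σ x)
    · exact Or.inr hx
    · exact Or.inl ⟨h, fun x h1 h2 => hx ⟨x, h1, h2⟩⟩

theorem rDerangement_tendsto (r : ℕ) (hr : 0 < r) :
    Filter.Tendsto (fun n : ℕ => (rDerangement r n : ℝ) / (n + r).factorial)
      Filter.atTop (nhds (1 / (r.factorial * Real.exp 1))) := by
  have hd : Filter.Tendsto (fun n : ℕ => (numDerangements (n + r) : ℝ) / (n + r).factorial)
      Filter.atTop (nhds (Real.exp (-1))) :=
    numDerangements_tendsto_inv_e.comp (Filter.tendsto_add_atTop_nat r)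
  have he : Filter.Tendsto (fun n : ℕ => (r : ℝ) ^ 2 / ((n + r : ℕ) : ℝ)) Filter.atTop (nhds 0) :=
    (tendsto_const_div_atTop_nhds_zero_nat ((r : ℝ) ^ 2)).comp (Filter.tendsto_add_atTop_nat r)
  have hlim : (1 / (r.factorial * Real.exp 1) : ℝ) = Real.exp (-1) / r.factorial := by
    rw [Real.exp_neg]; field_simp
  have hf : (0 : ℝ) < r.factorial := by exact_mod_cast r.factorial_pos
  have lo := (hd.sub he).div_const (r.factorial : ℝ)
  have hi := (hd.div_const (r.factorial : ℝ)).add he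
  rw [sub_zero, ← hlim] at lo
  rw [add_zero, ← hlim] at hi
  have key : ∀ n : ℕ,
      ((numDerangements (n + r) : ℝ) / (n + r).factorial - (r : ℝ) ^ 2 / ((n + r : ℕ) : ℝ))
          / r.factorial ≤ (rDerangement r n : ℝ) / (n + r).factorial ∧
      (rDerangement r n : ℝ) / (n + r).factorial ≤
        (numDerangements (n + r) : ℝ) / (n + r).factorial / r.factorial
          + (r : ℝ) ^ 2 / ((n + r : ℕ) : ℝ) := by
    intro n
    obtain ⟨g, b, h1, h2, h3, h4, h5⟩ := rDer_bounds r n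
    have hm : (0 : ℝ) < ((n + r : ℕ) : ℝ) := by exact_mod_cast (by omega : 0 < n + r)
    have hM : (0 : ℝ) < (n + r).factorial := by exact_mod_cast (n + r).factorial_pos
    have h1' : (g : ℝ) ≤ rDerangement r n := by exact_mod_cast h1
    have h2' : (rDerangement r n : ℝ) ≤ g + b := by exact_mod_cast h2
    have h3' : (r.factorial : ℝ) * g ≤ numDerangements (n + r) := by exact_mod_cast h3
    have h4' : (numDerangements (n + r) : ℝ) ≤ r.factorial * g + b := by exact_mod_cast h4
    have h5' : (b : ℝ) * ((n + r : ℕ) : ℝ) ≤ (r : ℝ) ^ 2 * (n + r).factorial := by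
      exact_mod_cast h5
    have hbb : (b : ℝ) / (n + r).factorial ≤ (r : ℝ) ^ 2 / ((n + r : ℕ) : ℝ) := by
      rw [div_le_div_iff₀ hM hm]; exact h5'
    constructor
    · rw [div_le_iff₀ hf]
      have : (numDerangements (n + r) : ℝ) / (n + r).factorial ≤
          (rDerangement r n : ℝ) / (n + r).factorial * r.factorial + b / (n + r).factorial := by
        rw [div_mul_eq_mul_div, ← add_div]
        gcongr
        nlinarith
      linarith
    · have : (rDerangement r n : ℝ) / (n + r).factorial ≤
          (numDerangements (n + r) : ℝ) / (n + r).factorial / r.factorial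
            + b / (n + r).factorial := by
        rw [div_right_comm, ← add_div]
        gcongr
        refine h2'.trans (add_le_add_left ?_ _)
        rw [le_div_iff₀ hf]; linarith
      linarith
  exact tendsto_of_tendsto_of_tendsto_of_le_of_le lo hi (fun n => (key n).1) (fun n => (key n).2)
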